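/- arXiv:2509.01501 — 2 statements merged into one kernel-verified Lean document; each statement's English description precedes it below -/
import Mathlib

section
/- Let m be a natural number, M a real number with M > 1, and let a_i, b_i, c_i be real numbers for i = 0, 1, …, m. Assume that a_i ≥ b_i for all i, and that c_i − b_i ≤ (M − 1) · ∑_{0 ≤ j < i} (a_j − b_j) for all i. Then ∑_{i=0}^{m} M^{−i} c_i ≤ ∑_{i=0}^{m} M^{−i} a_i, and equality holds if and only if a_i = b_i = c_i for all i = 0, …, m. -/
/-- Summation by parts with geometric weights: the weighted sum of `a - c` is a multiple of the
total sum of `a - b` plus the weighted sum of the slacks in the bounds on `c - b`. -/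
theorem sum_geom_mul_sub_eq (n : ℕ) {M : ℝ} (hM : M ≠ 0) (a b c : ℕ → ℝ) :
    ∑ i ∈ Finset.range n, M⁻¹ ^ i * a i - ∑ i ∈ Finset.range n, M⁻¹ ^ i * c i =
      M * M⁻¹ ^ n * ∑ j ∈ Finset.range n, (a j - b j) +
        ∑ i ∈ Finset.range n,
          M⁻¹ ^ i * ((M - 1) * ∑ j ∈ Finset.range i, (a j - b j) - (c i - b i)) := by
  induction n with
  | zero => simp
  | succ n ih =>
    have h : M * M⁻¹ ^ (n + 1) = M⁻¹ ^ n := by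
      rw [pow_succ', mul_inv_cancel_left₀ hM]
    rw [h]
    simp only [Finset.sum_range_succ _ n]
    linear_combination ih

/-- Elementary inequality (Lemma 4.12): for sequences `a b c : ℕ → ℝ` indexed by
`0, …, m` with `a i ≥ b i` and `c i - b i ≤ (M - 1) * ∑_{j < i} (a j - b j)`,
we have `∑ M⁻ⁱ c i ≤ ∑ M⁻ⁱ a i`, with equality iff `a i = b i = c i` for all `i ≤ m`. -/
theorem stmt_0 (m : ℕ) (M : ℝ) (hM : 1 < M) (a b c : ℕ → ℝ)
    (hab : ∀ i ≤ m, b i ≤ a i)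
    (hc : ∀ i ≤ m, c i - b i ≤ (M - 1) * ∑ j ∈ Finset.range i, (a j - b j)) :
    (∑ i ∈ Finset.range (m + 1), M⁻¹ ^ i * c i ≤
        ∑ i ∈ Finset.range (m + 1), M⁻¹ ^ i * a i) ∧
      ((∑ i ∈ Finset.range (m + 1), M⁻¹ ^ i * c i =
          ∑ i ∈ Finset.range (m + 1), M⁻¹ ^ i * a i) ↔
        ∀ i ≤ m, a i = b i ∧ b i = c i) := by
  have hM0 : 0 < M := by linarith
  have key := sum_geom_mul_sub_eq (m + 1) hM0.ne' a b c
  have hd : ∀ i ∈ Finset.range (m + 1), 0 ≤ a i - b i := fun i hi =>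
    sub_nonneg.2 (hab i (Finset.mem_range_succ_iff.1 hi))
  have he : ∀ i ∈ Finset.range (m + 1),
      0 ≤ M⁻¹ ^ i * ((M - 1) * ∑ j ∈ Finset.range i, (a j - b j) - (c i - b i)) := fun i hi =>
    mul_nonneg (by positivity) (sub_nonneg.2 (hc i (Finset.mem_range_succ_iff.1 hi)))
  have hpos : 0 < M * M⁻¹ ^ (m + 1) := by positivity
  have hD := mul_nonneg hpos.le (Finset.sum_nonneg hd)
  have hE := Finset.sum_nonneg he
  refine ⟨by linarith, fun h => ?_, fun h => ?_⟩
  · have hD0 := (mul_eq_zero.1 (le_antisymm (by linarith) hD)).resolve_left hpos.ne'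
    have hE0 := le_antisymm (by linarith) hE
    rw [Finset.sum_eq_zero_iff_of_nonneg hd] at hD0
    rw [Finset.sum_eq_zero_iff_of_nonneg he] at hE0
    intro i hi
    have hmem := Finset.mem_range_succ_iff.2 hi
    have hsum : ∑ j ∈ Finset.range i, (a j - b j) = 0 := Finset.sum_eq_zero fun j hj =>
      hD0 j (Finset.mem_range_succ_iff.2 ((Finset.mem_range.1 hj).le.trans hi))
    have hei := (mul_eq_zero.1 (hE0 i hmem)).resolve_left (by positivity)
    rw [hsum] at hei
    exact ⟨sub_eq_zero.1 (hD0 i hmem), by linarith⟩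
  · refine Finset.sum_congr rfl fun i hi => ?_
    obtain ⟨hai, hbi⟩ := h i (Finset.mem_range_succ_iff.1 hi)
    rw [hai, hbi]
end

section
/- Let m be a natural number, M a real number with M > 1, and let a_i, c_i be real numbers for i = 0, 1, …, m. Assume that a_i ≥ 0 for all i and that c_i ≤ (M − 1) · ∑_{0 ≤ j < i} a_j for all i. Then ∑_{i=0}^{m} M^{−i} c_i ≤ ∑_{j=0}^{m−1} M^{−j} a_j (where the right-hand side is the empty sum 0 when m = 0). -/
/-- Summation by parts against a geometric weight:
`∑_{i ≤ m} M⁻ⁱ (M - 1) S i = ∑_{j < m} M⁻ʲ a j - M⁻ᵐ S m`, where `S i = ∑_{j < i} a j`. -/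
theorem sum_inv_pow_mul_partial_sum {K : Type*} [Field K] {M : K} (hM : M ≠ 0) (a : ℕ → K)
    (m : ℕ) :
    ∑ i ∈ Finset.range (m + 1), M⁻¹ ^ i * ((M - 1) * ∑ j ∈ Finset.range i, a j) =
      ∑ j ∈ Finset.range m, M⁻¹ ^ j * a j - M⁻¹ ^ m * ∑ j ∈ Finset.range m, a j := by
  induction m with
  | zero => simp
  | succ m ih =>
    have h : M⁻¹ ^ m = M⁻¹ ^ (m + 1) * M := by
      rw [pow_succ, mul_assoc, inv_mul_cancel₀ hM, mul_one]
    rw [Finset.sum_range_succ, ih, Finset.sum_range_succ, Finset.sum_range_succ, h]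
    ring

/-- Strengthened intermediate inequality in the proof of Lemma 4.12 (normalized case
`b i = 0`): if `a i ≥ 0` and `c i ≤ (M - 1) * ∑_{j < i} a j` for `i = 0, …, m`, then
`∑_{i=0}^m M⁻ⁱ c i ≤ ∑_{j=0}^{m-1} M⁻ʲ a j`. -/
theorem stmt_1 (m : ℕ) (M : ℝ) (hM : 1 < M) (a c : ℕ → ℝ)
    (ha : ∀ i ≤ m, 0 ≤ a i)
    (hc : ∀ i ≤ m, c i ≤ (M - 1) * ∑ j ∈ Finset.range i, a j) :
    ∑ i ∈ Finset.range (m + 1), M⁻¹ ^ i * c i ≤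
      ∑ j ∈ Finset.range m, M⁻¹ ^ j * a j := by
  have hM0 : 0 < M := zero_lt_one.trans hM
  have hS : 0 ≤ M⁻¹ ^ m * ∑ j ∈ Finset.range m, a j :=
    mul_nonneg (by positivity)
      (Finset.sum_nonneg fun j hj => ha j (Finset.mem_range.mp hj).le)
  calc ∑ i ∈ Finset.range (m + 1), M⁻¹ ^ i * c i
      ≤ ∑ i ∈ Finset.range (m + 1), M⁻¹ ^ i * ((M - 1) * ∑ j ∈ Finset.range i, a j) :=
        Finset.sum_le_sum fun i hi => mul_le_mul_of_nonneg_left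
          (hc i (Nat.lt_succ_iff.mp (Finset.mem_range.mp hi))) (by positivity)
    _ = ∑ j ∈ Finset.range m, M⁻¹ ^ j * a j - M⁻¹ ^ m * ∑ j ∈ Finset.range m, a j :=
        sum_inv_pow_mul_partial_sum hM0.ne' a m
    _ ≤ ∑ j ∈ Finset.range m, M⁻¹ ^ j * a j := sub_le_self _ hS
end
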